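/- Let X be a finite-dimensional real Banach space of dimension at least 2. If S_P(X) < 1/2, then ε₀(X) < 2, i.e. there exists ε ∈ (0, 2) such that δ_X(ε') > 0 for every ε' ∈ (ε, 2]. -/

import Mathlib

/-- The P-angle constant `S_P(X)`. -/
noncomputable def SP (X : Type*) [NormedAddCommGroup X] [NormedSpace ℝ X] : ℝ :=
  sSup {r : ℝ | ∃ x y : X, ‖x‖ = 1 ∧ ‖y‖ = 1 ∧ x ≠ y ∧ x ≠ -y ∧
    r = (‖x + y‖ ^ 2 + ‖x - y‖ ^ 2 - 4) / (2 * ‖x + y‖ * ‖x - y‖)}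

/-- The modulus of convexity `δ_X(ε)`. -/
noncomputable def deltaX (X : Type*) [NormedAddCommGroup X] [NormedSpace ℝ X] (ε : ℝ) : ℝ :=
  sInf {r : ℝ | ∃ x y : X, ‖x‖ = 1 ∧ ‖y‖ = 1 ∧ ‖x - y‖ = ε ∧ r = 1 - ‖x + y‖ / 2}

/-- The P-angle quotient of two unit vectors never exceeds `1 / 2`. -/
theorem angleP_le_half {X : Type*} [NormedAddCommGroup X] [NormedSpace ℝ X] {x y : X}
    (hx : ‖x‖ = 1) (hy : ‖y‖ = 1) (hxy : x ≠ y) (hxy' : x ≠ -y) :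
    (‖x + y‖ ^ 2 + ‖x - y‖ ^ 2 - 4) / (2 * ‖x + y‖ * ‖x - y‖) ≤ 1 / 2 := by
  have ha : 0 < ‖x + y‖ := norm_pos_iff.mpr fun h => hxy' (eq_neg_of_add_eq_zero_left h)
  have hb : 0 < ‖x - y‖ := norm_pos_iff.mpr (sub_ne_zero.mpr hxy)
  have ha2 : ‖x + y‖ ≤ 2 := by linarith [norm_add_le x y]
  have hb2 : ‖x - y‖ ≤ 2 := by linarith [norm_sub_le x y]
  rw [div_le_iff₀ (by positivity)]
  rcases le_total ‖x + y‖ ‖x - y‖ with hle | hle <;> nlinarith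

theorem le_SP {X : Type*} [NormedAddCommGroup X] [NormedSpace ℝ X] {x y : X}
    (hx : ‖x‖ = 1) (hy : ‖y‖ = 1) (hxy : x ≠ y) (hxy' : x ≠ -y) :
    (‖x + y‖ ^ 2 + ‖x - y‖ ^ 2 - 4) / (2 * ‖x + y‖ * ‖x - y‖) ≤ SP X := by
  refine le_csSup ⟨1 / 2, ?_⟩ ⟨x, y, hx, hy, hxy, hxy', rfl⟩
  rintro _ ⟨u, v, hu, hv, hne, hneg, rfl⟩
  exact angleP_le_half hu hv hne hneg

/-- In dimension at least two, every distance in `[0, 2]` is attained on the unit sphere. -/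
theorem exists_unit_vectors_norm_sub_eq {X : Type*} [NormedAddCommGroup X] [NormedSpace ℝ X]
    (hrank : 1 < Module.rank ℝ X) {ε : ℝ} (h0 : 0 ≤ ε) (h2 : ε ≤ 2) :
    ∃ x y : X, ‖x‖ = 1 ∧ ‖y‖ = 1 ∧ ‖x - y‖ = ε := by
  have : Nontrivial X := rank_pos_iff_nontrivial.mp (zero_lt_one.trans hrank)
  obtain ⟨x, hx⟩ := exists_norm_eq X zero_le_one
  have hneg : ‖x - -x‖ = 2 := by
    rw [sub_neg_eq_add, ← two_smul ℝ x, norm_smul, hx]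
    norm_num
  obtain ⟨y, hy, hxy⟩ := (isPreconnected_sphere hrank (0 : X) 1).intermediate_value
    (a := x) (b := -x) (f := fun y => ‖x - y‖) (by simpa using hx) (by simpa using hx)
    (by fun_prop) (show ε ∈ Set.Icc ‖x - x‖ ‖x - -x‖ from ⟨by simpa using h0, hneg ▸ h2⟩)
  exact ⟨x, y, hx, by simpa using hy, hxy⟩

theorem stmt_16 (X : Type*) [NormedAddCommGroup X] [NormedSpace ℝ X]
    [FiniteDimensional ℝ X] (hdim : 2 ≤ Module.rank ℝ X) (h : SP X < 1 / 2) :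
    ∃ ε : ℝ, ε ∈ Set.Ioo (0 : ℝ) 2 ∧ ∀ ε' : ℝ, ε' ∈ Set.Ioc ε 2 → 0 < deltaX X ε' := by
  have hrank : 1 < Module.rank ℝ X := lt_of_lt_of_le Cardinal.one_lt_two hdim
  set s : ℝ := max (SP X) 0 with hs
  have hs0 : 0 ≤ s := le_max_right _ _
  have hs2 : s < 1 / 2 := max_lt h (by norm_num)
  refine ⟨2 - (1 - 2 * s) / 2, ⟨by linarith, by linarith⟩, fun ε' hε' => ?_⟩
  refine lt_of_lt_of_le (b := (1 - 2 * s) / 4) (by linarith) (le_csInf ?_ ?_)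
  · obtain ⟨x, y, hx, hy, hxy⟩ :=
      exists_unit_vectors_norm_sub_eq hrank (by linarith [hε'.1]) hε'.2
    exact ⟨_, x, y, hx, hy, hxy, rfl⟩
  · rintro _ ⟨x, y, hx, hy, hxy, rfl⟩
    have hb2 : ‖x - y‖ ≤ 2 := hxy.trans_le hε'.2
    have hb : 2 - (1 - 2 * s) / 2 < ‖x - y‖ := hxy ▸ hε'.1
    by_contra! hlt
    have ha : 2 - (1 - 2 * s) / 2 < ‖x + y‖ := by linarith
    have ha2 : ‖x + y‖ ≤ 2 := by linarith [norm_add_le x y]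
    have ha0 : 0 < ‖x + y‖ := by linarith
    have hb0 : 0 < ‖x - y‖ := by linarith
    have hne : x ≠ y := sub_ne_zero.mp (norm_pos_iff.mp hb0)
    have hne' : x ≠ -y := fun he => norm_pos_iff.mp ha0 (by rw [he, neg_add_cancel])
    have hle := (le_SP hx hy hne hne').trans (le_max_left _ 0)
    rw [← hs, div_le_iff₀ (by positivity)] at hle
    have hab : ‖x + y‖ * ‖x - y‖ ≤ 2 * 2 := by gcongr
    have hsab := mul_le_mul_of_nonneg_left hab hs0
    nlinarith [mul_self_lt_mul_self (by linarith) ha, mul_self_lt_mul_self (by linarith) hb,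
      sq_nonneg (1 - 2 * s)]
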